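/- Let k₀ > 0, r_M > 0 and T > 0, let t ↦ R_t be a continuous map from [0,T] into SO(3), and let f₁, f₂ ∈ L¹(ℝ³) have compact support contained in the open ball B_{r_M} = {x ∈ ℝ³ : ‖x‖₂ < r_M}. For i = 1,2 define the forward data D_i : ℝ² × [0,T] → ℂ by D_i(x', t) = ∫_{ℝ³} f_i(R_t y) e^{i k₀ y₃} · e^{i k₀ ‖(x', r_M) − y‖₂} / (4π ‖(x', r_M) − y‖₂) dy + e^{i k₀ r_M}. Let κ(y') = √(k₀² − ‖y'‖₂²) and h(y') = (y'₁, y'₂, κ(y') − k₀) ∈ ℝ³ for y' ∈ ℝ² with ‖y'‖₂ < k₀, and suppose the set Y = {R_t h(y') : ‖y'‖₂ < k₀, t ∈ [0,T]} ⊂ ℝ³ has positive Lebesgue measure. If D₁(x', t) = D₂(x', t) for all x' ∈ ℝ² and t ∈ [0,T], then f₁ = f₂ almost everywhere. -/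

import Mathlib

open MeasureTheory Matrix Set

/-- The point `(x'₁, x'₂, r_M) ∈ ℝ³` on the measurement plane. -/
noncomputable def measPoint (rM : ℝ) (x' : EuclideanSpace ℝ (Fin 2)) :
    EuclideanSpace ℝ (Fin 3) :=
  (WithLp.equiv 2 (Fin 3 → ℝ)).symm ![x' 0, x' 1, rM]

/-- The Born-approximation forward data
`D f (x', t) = ∫ f(R_t y) e^{i k₀ y₃} e^{i k₀ ‖(x',r_M) - y‖}/(4π‖(x',r_M) - y‖) dy
  + e^{i k₀ r_M}`. -/
noncomputable def fwdData (k₀ rM : ℝ) (R : ℝ → Matrix (Fin 3) (Fin 3) ℝ)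
    (f : EuclideanSpace ℝ (Fin 3) → ℂ) (x' : EuclideanSpace ℝ (Fin 2)) (t : ℝ) : ℂ :=
  (∫ y : EuclideanSpace ℝ (Fin 3),
      f ((WithLp.equiv 2 (Fin 3 → ℝ)).symm ((R t).mulVec (WithLp.equiv 2 (Fin 3 → ℝ) y))) *
        Complex.exp (Complex.I * (k₀ : ℂ) * ((y 2 : ℝ) : ℂ)) *
        (Complex.exp (Complex.I * (k₀ : ℂ) * ((‖measPoint rM x' - y‖ : ℝ) : ℂ)) /
          (((4 * Real.pi * ‖measPoint rM x' - y‖ : ℝ) : ℂ)))) +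
    Complex.exp (Complex.I * (k₀ : ℂ) * (rM : ℂ))

/-- The point `h(y') = (y'₁, y'₂, κ(y') - k₀)` with `κ(y') = √(k₀² - ‖y'‖²)`. -/
noncomputable def semiSpherePoint (k₀ : ℝ) (y' : EuclideanSpace ℝ (Fin 2)) :
    EuclideanSpace ℝ (Fin 3) :=
  (WithLp.equiv 2 (Fin 3 → ℝ)).symm ![y' 0, y' 1, Real.sqrt (k₀ ^ 2 - ‖y'‖ ^ 2) - k₀]

section

open Filter Topology FourierTransform

theorem differentiableAt_integral_mul_cexp {α : Type*} [MeasurableSpace α] {μ : Measure α}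
    {g L : α → ℂ} {z₀ : ℂ} {s : Set ℂ} {bound : α → ℝ} (hs : s ∈ 𝓝 z₀)
    (hg : AEStronglyMeasurable g μ) (hL : AEStronglyMeasurable L μ)
    (hint : Integrable (fun a => g a * Complex.exp (z₀ * L a)) μ) (hbound : Integrable bound μ)
    (hle : ∀ a, ∀ z ∈ s, ‖g a * (Complex.exp (z * L a) * L a)‖ ≤ bound a) :
    DifferentiableAt ℂ (fun z => ∫ a, g a * Complex.exp (z * L a) ∂μ) z₀ := by
  have hmeas : ∀ z : ℂ, AEStronglyMeasurable (fun a => Complex.exp (z * L a)) μ := fun z =>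
    Complex.continuous_exp.comp_aestronglyMeasurable (hL.const_mul z)
  refine (hasDerivAt_integral_of_dominated_loc_of_deriv_le (𝕜 := ℂ)
    (F := fun z a => g a * Complex.exp (z * L a))
    (F' := fun z a => g a * (Complex.exp (z * L a) * L a)) (bound := bound) hs
    (Eventually.of_forall fun z => hg.mul (hmeas z)) hint (hg.mul ((hmeas z₀).mul hL))
    (Eventually.of_forall hle) hbound
    (Eventually.of_forall fun a z _ => ?_)).2.differentiableAt
  have := ((hasDerivAt_mul_const (x := z) (L a)).cexp).const_mul (g a)
  simpa using this

theorem AnalyticOnNhd.eq_zero_of_volume_ne_zero {g : ℝ → ℂ} (hg : AnalyticOnNhd ℝ g univ)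
    (hvol : volume {t | g t = 0} ≠ 0) (t : ℝ) : g t = 0 := by
  rcases hg.eqOn_zero_or_eventually_ne_zero_of_preconnected isPreconnected_univ with h | h
  · exact h (mem_univ t)
  · have h' := ae_restrict_le_codiscreteWithin (μ := volume) MeasurableSet.univ h
    rw [Measure.restrict_univ] at h'
    have h'' : ∀ᵐ t : ℝ, g t ≠ 0 := h'
    exact absurd (by simpa only [ae_iff, not_not] using h'') hvol

/-- A continuous function on `ℝⁿ` that is analytic in each variable and vanishes on a set of
positive measure vanishes identically. -/
theorem eq_zero_of_analytic_slices_of_volume_ne_zero : ∀ (n : ℕ) (F : (Fin n → ℝ) → ℂ),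
    Continuous F →
    (∀ x i, AnalyticOnNhd ℝ (fun t => F (Function.update x i t)) univ) →
    volume {x | F x = 0} ≠ 0 → ∀ x, F x = 0 := by
  intro n
  induction n with
  | zero =>
    intro F _ _ hvol x
    obtain ⟨y, hy⟩ := nonempty_of_measure_ne_zero hvol
    rwa [Subsingleton.elim x y]
  | succ n ih =>
    intro F hF hslice hvol x
    have hcons : Continuous fun p : ℝ × (Fin n → ℝ) => F (Fin.cons p.1 p.2) :=
      hF.comp (by fun_prop)
    have hpos : ¬ (∀ᵐ a : ℝ, volume {y : Fin n → ℝ | F (Fin.cons a y) = 0} = 0) := by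
      intro hae
      apply hvol
      have hmp := (volume_preserving_piFinSuccAbove (fun _ : Fin (n + 1) => ℝ) 0).symm
      rw [← hmp.measure_preimage_equiv]
      have hm : MeasurableSet {p : ℝ × (Fin n → ℝ) | F (Fin.cons p.1 p.2) = 0} :=
        (isClosed_eq hcons continuous_const).measurableSet
      have := (Measure.measure_prod_null (μ := (volume : Measure ℝ))
        (ν := (volume : Measure (Fin n → ℝ))) hm).2 hae
      rw [← Measure.volume_eq_prod] at this
      convert this using 2
      ext p
      change F (Fin.insertNth 0 p.1 p.2) = 0 ↔ F (Fin.cons p.1 p.2) = 0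
      rw [Fin.insertNth_zero']
    have hzero : ∀ a, volume {y : Fin n → ℝ | F (Fin.cons a y) = 0} ≠ 0 →
        ∀ y, F (Fin.cons a y) = 0 := by
      intro a ha
      refine ih (fun y => F (Fin.cons a y)) (hcons.comp (Continuous.prodMk_right a)) (fun y i => ?_) ha
      have := hslice (Fin.cons a y) i.succ
      simpa only [← Fin.cons_update] using this
    have key : ∀ t, F (Function.update x 0 t) = 0 := by
      refine (hslice x 0).eq_zero_of_volume_ne_zero fun h0 => hpos ?_
      rw [ae_iff]
      refine measure_mono_null (fun a ha => ?_) h0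
      have := hzero a ha (Fin.tail x)
      rw [mem_ofPred_eq, ← Fin.cons_self_tail x, Fin.update_cons_zero]
      exact this
    simpa using key (x 0)

theorem analyticOnNhd_fourier_line {V : Type*} [NormedAddCommGroup V] [InnerProductSpace ℝ V]
    [MeasurableSpace V] [BorelSpace V] [FiniteDimensional ℝ V] {f : V → ℂ}
    (hf : Integrable f) (hc : HasCompactSupport f) (w e : V) :
    AnalyticOnNhd ℝ (fun t : ℝ => 𝓕 f (w + t • e)) univ := by
  obtain ⟨C, hC⟩ : ∃ C, ∀ v ∈ tsupport f, ‖v‖ ≤ C := hc.isBounded.exists_norm_le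
  set L : V → ℂ := fun v => ((-2 * Real.pi * inner ℝ v e : ℝ) : ℂ) * Complex.I with hL
  set g : V → ℂ := fun v => Complex.exp (((-2 * Real.pi * inner ℝ v w : ℝ) : ℂ) * Complex.I) * f v
    with hg
  have hLc : Continuous L := by fun_prop
  have hgm : AEStronglyMeasurable g := by
    refine (Continuous.aestronglyMeasurable ?_).mul hf.1
    fun_prop
  have hgn : ∀ v, ‖g v‖ = ‖f v‖ := fun v => by
    rw [hg]; simp only [norm_mul, Complex.norm_exp_ofReal_mul_I, one_mul]
  set K : ℝ := 2 * Real.pi * (C * ‖e‖) with hK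
  have hLn : ∀ v ∈ tsupport f, ‖L v‖ ≤ K := fun v hv => by
    rw [hL]
    simp only [norm_mul, Complex.norm_I, mul_one, Complex.norm_real, norm_neg, Real.norm_eq_abs,
      Nat.abs_ofNat, abs_of_pos Real.pi_pos]
    rw [hK]
    gcongr
    exact (abs_real_inner_le_norm v e).trans (by gcongr; exact hC v hv)
  have hexp : ∀ (z : ℂ), ∀ v ∈ tsupport f, ‖Complex.exp (z * L v)‖ ≤ Real.exp (‖z‖ * K) := by
    intro z v hv
    refine (Complex.norm_exp_le_exp_norm _).trans (Real.exp_le_exp.2 ?_)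
    rw [norm_mul]
    gcongr
    exact hLn v hv
  have hdiff : Differentiable ℂ fun z : ℂ => ∫ v, g v * Complex.exp (z * L v) := by
    intro z₀
    refine differentiableAt_integral_mul_cexp (Metric.ball_mem_nhds z₀ one_pos)
      (bound := fun v => ‖f v‖ * (Real.exp ((‖z₀‖ + 1) * |K|) * |K|)) hgm
      hLc.aestronglyMeasurable ?_ (hf.norm.mul_const _) ?_
    · refine (hf.norm.mul_const (Real.exp (‖z₀‖ * K))).mono' (hgm.mul
        (Continuous.aestronglyMeasurable (by fun_prop))) (Eventually.of_forall fun v => ?_)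
      rw [norm_mul, hgn]
      by_cases hv : v ∈ tsupport f
      · gcongr; exact hexp _ v hv
      · simp [image_eq_zero_of_notMem_tsupport hv]
    · intro v z hz
      rw [norm_mul, hgn, norm_mul]
      by_cases hv : v ∈ tsupport f
      · have hzn : ‖z‖ ≤ ‖z₀‖ + 1 := by
          have := norm_sub_norm_le z z₀
          rw [mem_ball_iff_norm] at hz
          linarith
        gcongr
        · refine (hexp z v hv).trans (Real.exp_le_exp.2 ?_)
          exact mul_le_mul hzn (le_abs_self K) ((norm_nonneg _).trans (hLn v hv)) (by positivity)
        · exact (hLn v hv).trans (le_abs_self K)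
      · simp [image_eq_zero_of_notMem_tsupport hv]
  have hA : AnalyticOnNhd ℂ (fun z : ℂ => ∫ v, g v * Complex.exp (z * L v)) univ :=
    hdiff.differentiableOn.analyticOnNhd isOpen_univ
  have hR := (hA.restrictScalars (𝕜 := ℝ)).comp
    (f := fun t : ℝ => (t : ℂ)) (s := univ) (Complex.ofRealCLM.analyticOnNhd univ)
    (fun _ _ => mem_univ _)
  refine hR.congr isOpen_univ fun t _ => ?_
  simp only [Function.comp_apply, Real.fourier_eq', smul_eq_mul]
  refine integral_congr_ae (Eventually.of_forall fun v => ?_)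
  simp only [hg, hL]
  rw [mul_right_comm, ← Complex.exp_add, inner_add_right, inner_smul_right]
  push_cast
  congr 2
  ring

theorem Integrable.ae_eq_zero_of_fourier_eq_zero {V : Type*} [NormedAddCommGroup V]
    [InnerProductSpace ℝ V] [MeasurableSpace V] [BorelSpace V] [FiniteDimensional ℝ V] {f : V → ℂ}
    (hf : Integrable f) (h : ∀ w, 𝓕 f w = 0) : f =ᵐ[volume] 0 := by
  refine ae_eq_zero_of_integral_contDiff_smul_eq_zero hf.locallyIntegrable fun g hg hgc => ?_
  have hgC : ContDiff ℝ (↑(⊤ : ℕ∞)) fun x => (g x : ℂ) := Complex.ofRealCLM.contDiff.comp hg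
  have hgcC : HasCompactSupport fun x => (g x : ℂ) := hgc.comp_left (g := fun r : ℝ => (r : ℂ)) rfl
  set φ : SchwartzMap V ℂ := hgcC.toSchwartzMap hgC with hφ
  set ψ : SchwartzMap V ℂ := 𝓕⁻ φ with hψ
  have h1 := VectorFourier.integral_fourierIntegral_smul_eq_flip (L := innerₗ V)
    (μ := volume) (ν := volume) (e := Real.fourierChar) (f := ψ) (g := f)
    Real.continuous_fourierChar continuous_inner ψ.integrable hf
  have h2 : ∀ x, VectorFourier.fourierIntegral Real.fourierChar volume (innerₗ V)
      ψ x = (g x : ℂ) := by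
    intro x
    have : 𝓕 (ψ : V → ℂ) x = φ x := by
      rw [← SchwartzMap.fourier_coe, hψ, FourierTransform.fourier_fourierInv_eq]
    exact this
  have h3 : ∀ x, VectorFourier.fourierIntegral Real.fourierChar volume (innerₗ V).flip f x = 0 := by
    intro x; rw [flip_innerₗ]; exact h x
  simp only [h2, h3, smul_eq_mul] at h1
  simpa [Complex.real_smul] using h1

theorem ae_eq_zero_of_volume_fourier_zero {n : ℕ} {f : EuclideanSpace ℝ (Fin n) → ℂ}
    (hf : Integrable f) (hc : HasCompactSupport f) (hvol : volume {w | 𝓕 f w = 0} ≠ 0) :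
    f =ᵐ[volume] 0 := by
  have hcont : Continuous (𝓕 f) :=
    VectorFourier.fourierIntegral_continuous Real.continuous_fourierChar continuous_inner hf
  refine Integrable.ae_eq_zero_of_fourier_eq_zero hf fun w => ?_
  have hmp := PiLp.volume_preserving_toLp (Fin n)
  refine eq_zero_of_analytic_slices_of_volume_ne_zero n (fun x => 𝓕 f (WithLp.toLp 2 x))
    (hcont.comp (PiLp.continuous_toLp 2 _)) (fun x i => ?_) ?_ (WithLp.ofLp w)
  · convert analyticOnNhd_fourier_line hf hc (WithLp.toLp 2 (Function.update x i 0))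
      (EuclideanSpace.single i (1 : ℝ)) using 4 with t
    ext j
    by_cases hj : j = i
    · subst hj; simp
    · simp [hj]
  · rw [← hmp.measure_preimage (isClosed_eq hcont continuous_const).measurableSet.nullMeasurableSet]
      at hvol
    exact hvol

theorem image_mul_sub_div_Ioi {a b : ℝ} (ha : 0 < a) (hb : 0 < b) :
    (fun v : ℝ => a * v - b / v) '' Ioi 0 = univ := by
  refine eq_univ_of_forall fun w => ?_
  have hs : |w| < √(w ^ 2 + 4 * a * b) := by
    rw [← Real.sqrt_sq_eq_abs]
    exact Real.sqrt_lt_sqrt (sq_nonneg w) (by nlinarith [mul_pos ha hb])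
  have hsq : √(w ^ 2 + 4 * a * b) ^ 2 = w ^ 2 + 4 * a * b := Real.sq_sqrt (by positivity)
  set s := √(w ^ 2 + 4 * a * b)
  have hws : 0 < w + s := by linarith [neg_abs_le w]
  refine ⟨(w + s) / (2 * a), by simp only [mem_Ioi]; positivity, ?_⟩
  simp only
  field_simp
  nlinarith

theorem image_div_Ioi {c : ℝ} (hc : 0 < c) : (fun v : ℝ => c / v) '' Ioi 0 = Ioi 0 := by
  ext w
  constructor
  · rintro ⟨v, hv, rfl⟩
    exact div_pos hc hv
  · intro hw
    exact ⟨c / w, div_pos hc hw, by simp only; field_simp⟩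

/-- The Glasser integrals `∫₀^∞ e^{-a²v²-b²/v²} dv` and `∫₀^∞ v⁻² e^{-a²v²-b²/v²} dv`. -/
theorem integral_exp_neg_sq_add_inv_sq {a b : ℝ} (ha : 0 < a) (hb : 0 < b) :
    IntegrableOn (fun v : ℝ => Real.exp (-(a ^ 2 * v ^ 2 + b ^ 2 / v ^ 2))) (Ioi 0) ∧
    IntegrableOn (fun v : ℝ => 1 / v ^ 2 * Real.exp (-(a ^ 2 * v ^ 2 + b ^ 2 / v ^ 2))) (Ioi 0) ∧
    ∫ v in Ioi (0 : ℝ), Real.exp (-(a ^ 2 * v ^ 2 + b ^ 2 / v ^ 2)) =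
      √Real.pi / (2 * a) * Real.exp (-(2 * a * b)) ∧
    ∫ v in Ioi (0 : ℝ), 1 / v ^ 2 * Real.exp (-(a ^ 2 * v ^ 2 + b ^ 2 / v ^ 2)) =
      √Real.pi / (2 * b) * Real.exp (-(2 * a * b)) := by
  set G : ℝ → ℝ := fun v => Real.exp (-(a * v - b / v) ^ 2) with hG
  have hGeq : ∀ v ∈ Ioi (0 : ℝ), Real.exp (-(a ^ 2 * v ^ 2 + b ^ 2 / v ^ 2)) =
      Real.exp (-(2 * a * b)) * G v := by
    intro v hv
    have hv0 : v ≠ 0 := ne_of_gt hv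
    rw [hG, ← Real.exp_add]
    congr 1
    field_simp
    ring
  have hder : ∀ v ∈ Ioi (0 : ℝ),
      HasDerivWithinAt (fun v : ℝ => a * v - b / v) (a + b / v ^ 2) (Ioi 0) v := by
    intro v hv
    have hv0 : v ≠ 0 := ne_of_gt hv
    have := ((hasDerivAt_id v).const_mul a).sub ((hasDerivAt_inv hv0).const_mul b)
    refine (this.congr_deriv ?_).hasDerivWithinAt
    field_simp
    ring
  have hinj : InjOn (fun v : ℝ => a * v - b / v) (Ioi 0) := by
    intro v hv w hw h
    have hv : 0 < v := hv
    have hw : 0 < w := hw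
    have h1 : (v - w) * (a * v * w + b) = 0 := by
      simp only at h
      field_simp at h
      linear_combination h
    rcases mul_eq_zero.1 h1 with h2 | h2
    · linarith
    · have : 0 < a * v * w + b := by positivity
      linarith
  have hgauss : Integrable fun w : ℝ => Real.exp (-w ^ 2) := by
    simpa using integrable_exp_neg_mul_sq (b := 1) one_pos
  have habs : ∀ v ∈ Ioi (0 : ℝ), |a + b / v ^ 2| * Real.exp (-(a * v - b / v) ^ 2) =
      a * G v + b * (1 / v ^ 2 * G v) := by
    intro v hv
    rw [abs_of_pos (by positivity), hG]
    ring
  have hsum : IntegrableOn (fun v => a * G v + b * (1 / v ^ 2 * G v)) (Ioi 0) := by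
    have := (integrableOn_image_iff_integrableOn_abs_deriv_smul measurableSet_Ioi hder hinj
      (fun w => Real.exp (-w ^ 2))).1 hgauss.integrableOn
    exact this.congr_fun (fun v hv => habs v hv) measurableSet_Ioi
  have hGm : Measurable G := by fun_prop
  have hGi : IntegrableOn G (Ioi 0) := by
    refine (hsum.const_mul (1 / a)).mono' hGm.aestronglyMeasurable
      ((ae_restrict_iff' measurableSet_Ioi).2 (Eventually.of_forall fun v hv => ?_))
    rw [Real.norm_of_nonneg (Real.exp_pos _).le, mul_add, ← mul_assoc, one_div_mul_cancel ha.ne',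
      one_mul]
    exact le_add_of_nonneg_right (by positivity)
  have hGi2 : IntegrableOn (fun v => 1 / v ^ 2 * G v) (Ioi 0) := by
    refine (hsum.const_mul (1 / b)).mono' (by fun_prop)
      ((ae_restrict_iff' measurableSet_Ioi).2 (Eventually.of_forall fun v hv => ?_))
    rw [Real.norm_of_nonneg (by positivity), mul_add, ← mul_assoc (1 / b) b, one_div_mul_cancel hb.ne',
      one_mul]
    exact le_add_of_nonneg_left (by positivity)
  have htot : a * (∫ v in Ioi 0, G v) + b * (∫ v in Ioi 0, 1 / v ^ 2 * G v) = √Real.pi := by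
    have h1 := integral_image_eq_integral_abs_deriv_smul measurableSet_Ioi hder hinj
      (fun w => Real.exp (-w ^ 2))
    rw [image_mul_sub_div_Ioi ha hb, Measure.restrict_univ] at h1
    have h2 : ∫ w : ℝ, Real.exp (-w ^ 2) = √Real.pi := by simpa using integral_gaussian 1
    rw [← h2, h1, ← integral_const_mul, ← integral_const_mul,
      ← integral_add (hGi.const_mul a) (hGi2.const_mul b)]
    exact (setIntegral_congr_fun measurableSet_Ioi fun v hv => habs v hv).symm
  have hflip : ∫ v in Ioi 0, G v = b / a * ∫ v in Ioi 0, 1 / v ^ 2 * G v := by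
    have hc : 0 < b / a := by positivity
    have hder' : ∀ v ∈ Ioi (0 : ℝ),
        HasDerivWithinAt (fun v : ℝ => b / a / v) (-(b / a / v ^ 2)) (Ioi 0) v := by
      intro v hv
      have hv0 : v ≠ 0 := ne_of_gt hv
      refine (((hasDerivAt_inv hv0).const_mul (b / a)).congr_deriv ?_).hasDerivWithinAt
      field_simp
    have hinj' : InjOn (fun v : ℝ => b / a / v) (Ioi 0) := by
      intro v hv w hw h
      have hv : 0 < v := hv
      have hw : 0 < w := hw
      simp only at h
      field_simp at h
      linarith
    have h1 := integral_image_eq_integral_abs_deriv_smul measurableSet_Ioi hder' hinj' G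
    rw [image_div_Ioi hc] at h1
    rw [h1, ← integral_const_mul]
    refine setIntegral_congr_fun measurableSet_Ioi fun v hv => ?_
    have hv : 0 < v := hv
    have hGG : G (b / a / v) = G v := by
      simp only [hG]
      congr 2
      rw [show a * (b / a / v) - b / (b / a / v) = -(a * v - b / v) by field_simp; ring]
      ring
    simp only [smul_eq_mul, hGG]
    rw [abs_neg, abs_of_pos (by positivity)]
    ring
  have hJ : ∫ v in Ioi 0, G v = √Real.pi / (2 * a) := by
    rw [eq_div_iff (by positivity)]
    have : a * (∫ v in Ioi 0, G v) = b * ∫ v in Ioi 0, 1 / v ^ 2 * G v := by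
      rw [hflip]; field_simp
    linarith
  have hJ2 : ∫ v in Ioi 0, 1 / v ^ 2 * G v = √Real.pi / (2 * b) := by
    rw [eq_div_iff (by positivity)]
    have : a * (∫ v in Ioi 0, G v) = b * ∫ v in Ioi 0, 1 / v ^ 2 * G v := by
      rw [hflip]; field_simp
    linarith
  have hGeq2 : ∀ v ∈ Ioi (0 : ℝ), 1 / v ^ 2 * Real.exp (-(a ^ 2 * v ^ 2 + b ^ 2 / v ^ 2)) =
      Real.exp (-(2 * a * b)) * (1 / v ^ 2 * G v) := by
    intro v hv
    rw [hGeq v hv]; ring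
  refine ⟨IntegrableOn.congr_fun (hGi.const_mul _) (fun v hv => (hGeq v hv).symm)
    measurableSet_Ioi, IntegrableOn.congr_fun (hGi2.const_mul _) (fun v hv => (hGeq2 v hv).symm)
    measurableSet_Ioi, ?_, ?_⟩
  · rw [setIntegral_congr_fun measurableSet_Ioi hGeq, integral_const_mul, hJ, mul_comm]
  · rw [setIntegral_congr_fun measurableSet_Ioi hGeq2, integral_const_mul, hJ2, mul_comm]

/-- The Fourier transform of the screened Green kernel `e^{-λr}/r`, `r = √(‖x‖² + z²)`, on a plane
at distance `z`, for `λ > 0`. -/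
theorem fourier_exp_neg_div_sqrt_of_pos {l z : ℝ} (hl : 0 < l) (hz : 0 < z)
    (ξ : EuclideanSpace ℝ (Fin 2)) :
    𝓕 (fun x : EuclideanSpace ℝ (Fin 2) =>
      Complex.exp (l * (-(√(‖x‖ ^ 2 + z ^ 2) : ℝ) : ℂ)) / (√(‖x‖ ^ 2 + z ^ 2) : ℝ)) ξ =
    ((2 * Real.pi * Real.exp (-(√(l ^ 2 + 4 * Real.pi ^ 2 * ‖ξ‖ ^ 2) * z)) /
      √(l ^ 2 + 4 * Real.pi ^ 2 * ‖ξ‖ ^ 2) : ℝ) : ℂ) := by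
  have hrpos : ∀ x : EuclideanSpace ℝ (Fin 2), 0 < √(‖x‖ ^ 2 + z ^ 2) := fun x =>
    Real.sqrt_pos.2 (by positivity)
  set m := √(l ^ 2 + 4 * Real.pi ^ 2 * ‖ξ‖ ^ 2) with hm
  have hmpos : 0 < m := Real.sqrt_pos.2 (by positivity)
  have hmsq : m ^ 2 = l ^ 2 + 4 * Real.pi ^ 2 * ‖ξ‖ ^ 2 := Real.sq_sqrt (by positivity)
  have hrsq : ∀ x : EuclideanSpace ℝ (Fin 2), √(‖x‖ ^ 2 + z ^ 2) ^ 2 = ‖x‖ ^ 2 + z ^ 2 :=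
    fun x => Real.sq_sqrt (by positivity)
  have hpi : √Real.pi ≠ 0 := (Real.sqrt_pos.2 Real.pi_pos).ne'
  set W : ℝ → ℝ := fun v => Real.exp (-(z ^ 2 * v ^ 2 + (l / 2) ^ 2 / v ^ 2)) with hW
  have hsub : ∀ x : EuclideanSpace ℝ (Fin 2),
      Complex.exp (l * (-(√(‖x‖ ^ 2 + z ^ 2) : ℝ) : ℂ)) / (√(‖x‖ ^ 2 + z ^ 2) : ℝ) =
      ((2 / √Real.pi : ℝ) : ℂ) * ∫ v in Ioi (0 : ℝ),
        (W v : ℂ) * Complex.exp (-((v ^ 2 : ℝ) : ℂ) * ‖x‖ ^ 2) := by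
    intro x
    have h := (integral_exp_neg_sq_add_inv_sq (hrpos x) (half_pos hl)).2.2.1
    have h1 : ∫ v in Ioi (0 : ℝ), (W v : ℂ) * Complex.exp (-((v ^ 2 : ℝ) : ℂ) * ‖x‖ ^ 2) =
        ((∫ v in Ioi (0 : ℝ),
          Real.exp (-(√(‖x‖ ^ 2 + z ^ 2) ^ 2 * v ^ 2 + (l / 2) ^ 2 / v ^ 2)) : ℝ) : ℂ) := by
      rw [← integral_complex_ofReal]
      refine integral_congr_ae (Eventually.of_forall fun v => ?_)
      simp only [hW, hrsq]
      push_cast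
      rw [← Complex.exp_add]
      congr 1
      ring
    rw [h1, h, ← Complex.ofReal_mul]
    have : 2 / √Real.pi * (√Real.pi / (2 * √(‖x‖ ^ 2 + z ^ 2)) *
        Real.exp (-(2 * √(‖x‖ ^ 2 + z ^ 2) * (l / 2)))) =
        Real.exp (l * -√(‖x‖ ^ 2 + z ^ 2)) / √(‖x‖ ^ 2 + z ^ 2) := by
      rw [show -(2 * √(‖x‖ ^ 2 + z ^ 2) * (l / 2)) = l * -√(‖x‖ ^ 2 + z ^ 2) by ring]
      have := (hrpos x).ne'
      field_simp
    rw [this]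
    push_cast
    rfl
  set P : EuclideanSpace ℝ (Fin 2) → ℝ → ℂ := fun x v =>
    Complex.exp (((-2 * Real.pi * inner ℝ x ξ : ℝ) : ℂ) * Complex.I) *
      ((W v : ℂ) * Complex.exp (-((v ^ 2 : ℝ) : ℂ) * ‖x‖ ^ 2)) with hP
  have hgfour : ∀ v ∈ Ioi (0 : ℝ), ∀ η : EuclideanSpace ℝ (Fin 2),
      ∫ x : EuclideanSpace ℝ (Fin 2), Complex.exp (((-2 * Real.pi * inner ℝ x η : ℝ) : ℂ) *
        Complex.I) * Complex.exp (-((v ^ 2 : ℝ) : ℂ) * ‖x‖ ^ 2) =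
      ((Real.pi / v ^ 2 * Real.exp (-(Real.pi ^ 2 * ‖η‖ ^ 2 / v ^ 2)) : ℝ) : ℂ) := by
    intro v hv η
    have hv : 0 < v := hv
    have h := fourier_gaussian_innerProductSpace (b := ((v ^ 2 : ℝ) : ℂ))
      (by rw [Complex.ofReal_re]; positivity) η
    rw [Real.fourier_eq'] at h
    simp only [smul_eq_mul] at h
    rw [h]
    simp only [finrank_euclideanSpace, Fintype.card_fin, Nat.cast_ofNat]
    rw [div_self two_ne_zero, Complex.cpow_one]
    push_cast
    congr 2
    ring
  have hgint : ∀ v ∈ Ioi (0 : ℝ), Integrable fun x : EuclideanSpace ℝ (Fin 2) =>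
      Complex.exp (-((v ^ 2 : ℝ) : ℂ) * ‖x‖ ^ 2) := by
    intro v hv
    have hv : 0 < v := hv
    have h := GaussianFourier.integrable_cexp_neg_mul_sq_norm_add (b := ((v ^ 2 : ℝ) : ℂ))
      (by rw [Complex.ofReal_re]; positivity) 0 (0 : EuclideanSpace ℝ (Fin 2))
    simpa using h
  have hnorm : ∀ x v, ‖P x v‖ = W v * ‖Complex.exp (-((v ^ 2 : ℝ) : ℂ) * ‖x‖ ^ 2)‖ := by
    intro x v
    simp only [hP]
    rw [norm_mul, norm_mul, Complex.norm_exp_ofReal_mul_I, one_mul, Complex.norm_real,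
      Real.norm_of_nonneg (Real.exp_pos _).le]
  have hWm : Measurable W := by fun_prop
  have hPm : AEStronglyMeasurable (Function.uncurry P)
      ((volume : Measure (EuclideanSpace ℝ (Fin 2))).prod (volume.restrict (Ioi (0 : ℝ)))) := by
    refine Measurable.aestronglyMeasurable ?_
    simp only [hP, Function.uncurry_def]
    fun_prop
  have hGlass := integral_exp_neg_sq_add_inv_sq hz (half_pos hl)
  have hgnorm : ∀ v ∈ Ioi (0 : ℝ), ∫ x : EuclideanSpace ℝ (Fin 2),
      ‖Complex.exp (-((v ^ 2 : ℝ) : ℂ) * ‖x‖ ^ 2)‖ = Real.pi / v ^ 2 := by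
    intro v hv
    have h := hgfour v hv 0
    simp only [inner_zero_right, mul_zero, Complex.ofReal_zero, zero_mul, Complex.exp_zero, one_mul,
      norm_zero, ne_eq, OfNat.ofNat_ne_zero, not_false_eq_true, zero_pow, zero_div, neg_zero,
      Real.exp_zero, mul_one] at h
    rw [← Complex.ofReal_inj, ← h, ← integral_complex_ofReal]
    refine integral_congr_ae (Eventually.of_forall fun x => ?_)
    simp only
    rw [← Complex.ofReal_pow, ← Complex.ofReal_neg, ← Complex.ofReal_mul, ← Complex.ofReal_exp,
      Complex.norm_real, Real.norm_of_nonneg (Real.exp_pos _).le]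
  have hPint : Integrable (Function.uncurry P)
      ((volume : Measure (EuclideanSpace ℝ (Fin 2))).prod (volume.restrict (Ioi (0 : ℝ)))) := by
    rw [integrable_prod_iff' hPm]
    constructor
    · refine (ae_restrict_iff' measurableSet_Ioi).2 (Eventually.of_forall fun v hv => ?_)
      refine (((hgint v hv).norm).const_mul (W v)).mono' ?_ (Eventually.of_forall fun x => ?_)
      · simp only [hP, Function.uncurry_def]
        exact Measurable.aestronglyMeasurable (by fun_prop)
      · exact (hnorm x v).le
    · simp only [Function.uncurry_apply_pair, hnorm, integral_const_mul]
      refine IntegrableOn.congr_fun (hGlass.2.1.const_mul Real.pi) (fun v hv => ?_)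
        measurableSet_Ioi
      rw [hgnorm v hv]
      ring
  rw [Real.fourier_eq']
  simp only [smul_eq_mul, hsub]
  have hstep : ∫ x : EuclideanSpace ℝ (Fin 2),
      Complex.exp (((-2 * Real.pi * inner ℝ x ξ : ℝ) : ℂ) * Complex.I) *
        (((2 / √Real.pi : ℝ) : ℂ) * ∫ v in Ioi (0 : ℝ),
          (W v : ℂ) * Complex.exp (-((v ^ 2 : ℝ) : ℂ) * ‖x‖ ^ 2)) =
      ((2 / √Real.pi : ℝ) : ℂ) * ∫ x, ∫ v in Ioi (0 : ℝ), P x v := by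
    rw [← integral_const_mul]
    refine integral_congr_ae (Eventually.of_forall fun x => ?_)
    simp only [hP]
    rw [integral_const_mul]
    ring
  rw [hstep, integral_integral_swap hPint]
  have hG2 := (integral_exp_neg_sq_add_inv_sq hz (half_pos hmpos)).2.2.2
  have hinner : ∫ v in Ioi (0 : ℝ), ∫ x, P x v = ((Real.pi * ∫ v in Ioi (0 : ℝ),
      1 / v ^ 2 * Real.exp (-(z ^ 2 * v ^ 2 + (m / 2) ^ 2 / v ^ 2)) : ℝ) : ℂ) := by
    rw [← integral_const_mul, ← integral_complex_ofReal]
    refine setIntegral_congr_fun measurableSet_Ioi fun v hv => ?_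
    have h1 : ∫ x, P x v = (W v : ℂ) *
        ((Real.pi / v ^ 2 * Real.exp (-(Real.pi ^ 2 * ‖ξ‖ ^ 2 / v ^ 2)) : ℝ) : ℂ) := by
      rw [← hgfour v hv ξ, ← integral_const_mul]
      refine integral_congr_ae (Eventually.of_forall fun x => ?_)
      simp only [hP]
      ring
    simp only [h1]
    rw [← Complex.ofReal_mul]
    congr 1
    simp only [hW]
    rw [show -(z ^ 2 * v ^ 2 + (m / 2) ^ 2 / v ^ 2) = -(z ^ 2 * v ^ 2 + (l / 2) ^ 2 / v ^ 2) +
      -(Real.pi ^ 2 * ‖ξ‖ ^ 2 / v ^ 2) by rw [div_pow m, hmsq]; ring, Real.exp_add]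
    ring
  rw [hinner, hG2, ← Complex.ofReal_mul]
  congr 1
  rw [show -(2 * z * (m / 2)) = -(m * z) by ring]
  have hpp : √Real.pi * √Real.pi = Real.pi := Real.mul_self_sqrt Real.pi_pos.le
  field_simp

theorem integrable_exp_neg_mul_norm {V : Type*} [NormedAddCommGroup V] [NormedSpace ℝ V]
    [FiniteDimensional ℝ V] [MeasurableSpace V] [BorelSpace V] (μ : Measure V)
    [μ.IsAddHaarMeasure] {c : ℝ} (hc : 0 < c) :
    Integrable (fun x : V => Real.exp (-(c * ‖x‖))) μ := by
  set n := Module.finrank ℝ V + 1 with hn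
  have h := (integrable_one_add_norm (E := V) (μ := μ) (r := n)
    (by rw [hn]; push_cast; linarith)).const_mul (Real.exp c * n.factorial / c ^ n)
  refine h.mono' (Continuous.aestronglyMeasurable (by fun_prop)) (Eventually.of_forall fun x => ?_)
  have h1 := Real.pow_div_factorial_le_exp (c * (1 + ‖x‖)) (by positivity) n
  have hx : 0 < 1 + ‖x‖ := by positivity
  rw [Real.norm_of_nonneg (Real.exp_pos _).le, Real.rpow_neg hx.le, Real.rpow_natCast,
    ← div_eq_mul_inv, div_div, le_div_iff₀ (by positivity), ← mul_pow]
  rw [div_le_iff₀ (by positivity), mul_one_add, Real.exp_add] at h1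
  calc Real.exp (-(c * ‖x‖)) * (c * (1 + ‖x‖)) ^ n
      ≤ Real.exp (-(c * ‖x‖)) * (Real.exp c * Real.exp (c * ‖x‖) * n.factorial) := by
        rw [mul_one_add]; gcongr
    _ = Real.exp c * n.factorial * (Real.exp (-(c * ‖x‖)) * Real.exp (c * ‖x‖)) := by ring
    _ = Real.exp c * n.factorial := by rw [← Real.exp_add]; simp

theorem le_sqrt_sq_add_sq_left (a z : ℝ) : a ≤ √(a ^ 2 + z ^ 2) :=
  Real.le_sqrt_of_sq_le (by nlinarith [sq_nonneg z])

theorem le_sqrt_sq_add_sq_right (a z : ℝ) : z ≤ √(a ^ 2 + z ^ 2) :=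
  Real.le_sqrt_of_sq_le (by nlinarith [sq_nonneg a])

theorem integrable_cexp_neg_div_sqrt {l : ℂ} {z : ℝ} (hl : 0 < l.re) (hz : 0 < z) :
    Integrable (fun x : EuclideanSpace ℝ (Fin 2) =>
      Complex.exp (l * (-(√(‖x‖ ^ 2 + z ^ 2) : ℝ) : ℂ)) / (√(‖x‖ ^ 2 + z ^ 2) : ℝ)) := by
  refine ((integrable_exp_neg_mul_norm volume hl).mul_const (1 / z)).mono'
    (Measurable.aestronglyMeasurable (by fun_prop)) (Eventually.of_forall fun x => ?_)
  have h1 := le_sqrt_sq_add_sq_left ‖x‖ z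
  have h2 := le_sqrt_sq_add_sq_right ‖x‖ z
  rw [norm_div, Complex.norm_exp, Complex.norm_real, Real.norm_of_nonneg (Real.sqrt_nonneg _),
    div_eq_mul_one_div, ← Complex.ofReal_neg, Complex.re_mul_ofReal, mul_neg]
  gcongr

theorem sq_add_ofReal_mem_slitPlane {l : ℂ} (hl : 0 < l.re) {s : ℝ} (hs : 0 ≤ s) :
    l ^ 2 + s ∈ Complex.slitPlane := by
  rw [Complex.mem_slitPlane_iff]
  by_cases him : l.im = 0
  · left
    simp only [Complex.add_re, sq, Complex.mul_re, him, Complex.ofReal_re]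
    nlinarith
  · right
    simp only [Complex.add_im, sq, Complex.mul_im, Complex.ofReal_im]
    intro h
    have : l.re * l.im = 0 := by linarith
    rcases mul_eq_zero.1 this with h | h
    · exact hl.ne' h
    · exact him h

/-- The Weyl formula for complex `λ` with positive real part. -/
theorem fourier_cexp_neg_div_sqrt {l : ℂ} {z : ℝ} (hl : 0 < l.re) (hz : 0 < z)
    (ξ : EuclideanSpace ℝ (Fin 2)) :
    𝓕 (fun x : EuclideanSpace ℝ (Fin 2) =>
      Complex.exp (l * (-(√(‖x‖ ^ 2 + z ^ 2) : ℝ) : ℂ)) / (√(‖x‖ ^ 2 + z ^ 2) : ℝ)) ξ =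
    2 * Real.pi * Complex.exp (-((l ^ 2 + (4 * Real.pi ^ 2 * ‖ξ‖ ^ 2 : ℝ)) ^ (2⁻¹ : ℂ) * z)) /
      (l ^ 2 + (4 * Real.pi ^ 2 * ‖ξ‖ ^ 2 : ℝ)) ^ (2⁻¹ : ℂ) := by
  set U : Set ℂ := {w | 0 < w.re} with hU
  have hUo : IsOpen U := isOpen_lt continuous_const Complex.continuous_re
  have hUp : IsPreconnected U := (convex_halfSpace_re_gt 0).isPreconnected
  have hs : (0 : ℝ) ≤ 4 * Real.pi ^ 2 * ‖ξ‖ ^ 2 := by positivity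
  have hrpos : ∀ x : EuclideanSpace ℝ (Fin 2), 0 < √(‖x‖ ^ 2 + z ^ 2) := fun x =>
    Real.sqrt_pos.2 (by positivity)
  set g : EuclideanSpace ℝ (Fin 2) → ℂ := fun x =>
    Complex.exp (((-2 * Real.pi * inner ℝ x ξ : ℝ) : ℂ) * Complex.I) /
      (√(‖x‖ ^ 2 + z ^ 2) : ℝ) with hg
  set L : EuclideanSpace ℝ (Fin 2) → ℂ := fun x => (-(√(‖x‖ ^ 2 + z ^ 2) : ℝ) : ℂ) with hL
  have hform : ∀ w : ℂ, 𝓕 (fun x : EuclideanSpace ℝ (Fin 2) =>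
      Complex.exp (w * (-(√(‖x‖ ^ 2 + z ^ 2) : ℝ) : ℂ)) / (√(‖x‖ ^ 2 + z ^ 2) : ℝ)) ξ =
      ∫ x, g x * Complex.exp (w * L x) := by
    intro w
    rw [Real.fourier_eq']
    refine integral_congr_ae (Eventually.of_forall fun x => ?_)
    simp only [hg, hL, smul_eq_mul]
    ring
  have hgm : AEStronglyMeasurable g := Measurable.aestronglyMeasurable (by fun_prop)
  have hLm : AEStronglyMeasurable L := Measurable.aestronglyMeasurable (by fun_prop)
  have hgn : ∀ x, ‖g x‖ = 1 / √(‖x‖ ^ 2 + z ^ 2) := fun x => by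
    simp only [hg]
    rw [norm_div, Complex.norm_exp_ofReal_mul_I, Complex.norm_real,
      Real.norm_of_nonneg (Real.sqrt_nonneg _)]
  have hLn : ∀ x, ‖L x‖ = √(‖x‖ ^ 2 + z ^ 2) := fun x => by
    simp only [hL]
    rw [norm_neg, Complex.norm_real, Real.norm_of_nonneg (Real.sqrt_nonneg _)]
  have hEn : ∀ (w : ℂ) x, ‖Complex.exp (w * L x)‖ = Real.exp (-(w.re * √(‖x‖ ^ 2 + z ^ 2))) := by
    intro w x
    simp only [hL]
    rw [Complex.norm_exp, ← Complex.ofReal_neg, Complex.re_mul_ofReal, mul_neg]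
  have hA : AnalyticOnNhd ℂ (fun w => ∫ x, g x * Complex.exp (w * L x)) U := by
    refine DifferentiableOn.analyticOnNhd (fun w hw => ?_) hUo
    have hw : 0 < w.re := hw
    refine (differentiableAt_integral_mul_cexp (s := {u | w.re / 2 < u.re})
      (bound := fun x => Real.exp (-(w.re / 2 * ‖x‖)))
      ((isOpen_lt continuous_const Complex.continuous_re).mem_nhds
        (show w.re / 2 < w.re by linarith)) hgm hLm ?_
      (integrable_exp_neg_mul_norm volume (half_pos hw)) ?_).differentiableWithinAt
    · refine (((integrable_exp_neg_mul_norm volume hw)).mul_const (1 / z)).mono'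
        (Measurable.aestronglyMeasurable (by fun_prop)) (Eventually.of_forall fun x => ?_)
      rw [norm_mul, hgn, hEn, mul_comm]
      have h1 := le_sqrt_sq_add_sq_left ‖x‖ z
      have h2 := le_sqrt_sq_add_sq_right ‖x‖ z
      gcongr
    · intro x u hu
      have hu : w.re / 2 < u.re := hu
      have h1 := le_sqrt_sq_add_sq_left ‖x‖ z
      rw [norm_mul, norm_mul, hgn, hEn, hLn, mul_comm (Real.exp _), ← mul_assoc,
        one_div_mul_cancel (hrpos x).ne', one_mul]
      have hu0 : 0 < u.re := (half_pos hw).trans hu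
      gcongr
  have hB : AnalyticOnNhd ℂ (fun w : ℂ => 2 * Real.pi *
      Complex.exp (-((w ^ 2 + (4 * Real.pi ^ 2 * ‖ξ‖ ^ 2 : ℝ)) ^ (2⁻¹ : ℂ) * z)) /
      (w ^ 2 + (4 * Real.pi ^ 2 * ‖ξ‖ ^ 2 : ℝ)) ^ (2⁻¹ : ℂ)) U := by
    refine DifferentiableOn.analyticOnNhd (fun w hw => ?_) hUo
    have hsl := sq_add_ofReal_mem_slitPlane hw hs
    have hroot : DifferentiableAt ℂ
        (fun w : ℂ => (w ^ 2 + (4 * Real.pi ^ 2 * ‖ξ‖ ^ 2 : ℝ)) ^ (2⁻¹ : ℂ)) w :=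
      DifferentiableAt.cpow_const (by fun_prop) hsl
    refine DifferentiableAt.differentiableWithinAt (DifferentiableAt.div ?_ hroot ?_)
    · exact ((hroot.mul_const _).neg.cexp).const_mul _
    · rw [Complex.cpow_ne_zero_iff_of_exponent_ne_zero (by norm_num)]
      exact Complex.slitPlane_ne_zero hsl
  rw [hform l]
  refine hA.eqOn_of_preconnected_of_frequently_eq hB hUp (z₀ := 1) (by simp [hU]) ?_ hl
  have hreal : ∀ t : ℝ, 0 < t → (∫ x, g x * Complex.exp ((t : ℂ) * L x)) = 2 * Real.pi *
      Complex.exp (-(((t : ℂ) ^ 2 + (4 * Real.pi ^ 2 * ‖ξ‖ ^ 2 : ℝ)) ^ (2⁻¹ : ℂ) * z)) /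
      ((t : ℂ) ^ 2 + (4 * Real.pi ^ 2 * ‖ξ‖ ^ 2 : ℝ)) ^ (2⁻¹ : ℂ) := by
    intro t ht
    rw [← hform, fourier_exp_neg_div_sqrt_of_pos ht hz]
    have : ((t : ℂ) ^ 2 + (4 * Real.pi ^ 2 * ‖ξ‖ ^ 2 : ℝ)) ^ (2⁻¹ : ℂ) =
        ((√(t ^ 2 + 4 * Real.pi ^ 2 * ‖ξ‖ ^ 2) : ℝ) : ℂ) := by
      rw [Real.sqrt_eq_rpow, Complex.ofReal_cpow (by positivity)]
      push_cast
      norm_num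
    rw [this]
    push_cast
    rfl
  have htend : Tendsto (fun t : ℝ => (t : ℂ)) (𝓝[>] 1) (𝓝[≠] (1 : ℂ)) := by
    refine tendsto_nhdsWithin_iff.2 ⟨?_, ?_⟩
    · exact (Complex.continuous_ofReal.tendsto' 1 1 (by simp)).mono_left nhdsWithin_le_nhds
    · filter_upwards [self_mem_nhdsWithin] with t ht
      have ht : 1 < t := ht
      simp only [mem_compl_iff, mem_singleton_iff]
      exact_mod_cast ht.ne'
  refine htend.frequently (Eventually.frequently ?_)
  filter_upwards [self_mem_nhdsWithin] with t ht
  exact hreal t (lt_trans one_pos ht)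

theorem tendsto_cpow_inv_two_of_lt {k s : ℝ} (hk : 0 < k) (hs : s < k ^ 2) :
    Tendsto (fun ε : ℝ => (((ε : ℂ) - k * Complex.I) ^ 2 + (s : ℝ)) ^ (2⁻¹ : ℂ)) (𝓝[>] 0)
      (𝓝 (-(√(k ^ 2 - s) * Complex.I))) := by
  set w : ℝ → ℂ := fun ε => ((ε : ℂ) - k * Complex.I) ^ 2 + (s : ℝ) with hw
  have hwre : ∀ ε, (w ε).re = ε ^ 2 - k ^ 2 + s := fun ε => by simp [hw, sq]
  have hwim : ∀ ε, (w ε).im = -(2 * ε * k) := fun ε => by simp [hw, sq]; ring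
  have hwc : Continuous w := by fun_prop
  have hw0 : w 0 = ((-(k ^ 2 - s) : ℝ) : ℂ) := by
    apply Complex.ext
    · rw [hwre, Complex.ofReal_re]; ring
    · rw [hwim, Complex.ofReal_im]; ring
  have hn0 : ‖w 0‖ = k ^ 2 - s := by
    rw [hw0, Complex.norm_real, norm_neg, Real.norm_of_nonneg (by linarith)]
  have hr0 : (w 0).re = -(k ^ 2 - s) := by rw [hw0, Complex.ofReal_re]
  have hlim : Tendsto (fun ε : ℝ => ((√((‖w ε‖ + (w ε).re) / 2) : ℝ) : ℂ) +
      ((-√((‖w ε‖ - (w ε).re) / 2) : ℝ) : ℂ) * Complex.I) (𝓝[>] 0)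
      (𝓝 (-(√(k ^ 2 - s) * Complex.I))) := by
    refine (Continuous.tendsto' ?_ 0 _ ?_).mono_left nhdsWithin_le_nhds
    · have := Complex.continuous_re.comp hwc
      simp only [Function.comp_def] at this
      fun_prop
    · rw [hn0, hr0, show (k ^ 2 - s + -(k ^ 2 - s)) / 2 = 0 by ring,
        show (k ^ 2 - s - -(k ^ 2 - s)) / 2 = k ^ 2 - s by ring]
      simp
  refine hlim.congr' ?_
  filter_upwards [self_mem_nhdsWithin] with ε hε
  have hε : 0 < ε := hε
  rw [← Complex.cpow_inv_two_re, ← Complex.cpow_inv_two_im_eq_neg_sqrt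
    (by rw [hwim]; nlinarith [mul_pos hε hk])]
  exact Complex.re_add_im _

theorem integral_fourier_mul_cexp_neg_div_sqrt {l : ℂ} {z : ℝ} (hl : 0 < l.re) (hz : 0 < z)
    (b : EuclideanSpace ℝ (Fin 2)) (χ : SchwartzMap (EuclideanSpace ℝ (Fin 2)) ℂ) :
    ∫ x, 𝓕 (χ : EuclideanSpace ℝ (Fin 2) → ℂ) x *
      (Complex.exp (l * (-(√(‖x - b‖ ^ 2 + z ^ 2) : ℝ) : ℂ)) / (√(‖x - b‖ ^ 2 + z ^ 2) : ℝ)) =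
    ∫ ξ, χ ξ * (Complex.exp (((-2 * Real.pi * inner ℝ b ξ : ℝ) : ℂ) * Complex.I) *
      (2 * Real.pi * Complex.exp (-((l ^ 2 + (4 * Real.pi ^ 2 * ‖ξ‖ ^ 2 : ℝ)) ^ (2⁻¹ : ℂ) * z)) /
      (l ^ 2 + (4 * Real.pi ^ 2 * ‖ξ‖ ^ 2 : ℝ)) ^ (2⁻¹ : ℂ))) := by
  set g : EuclideanSpace ℝ (Fin 2) → ℂ := fun x =>
    Complex.exp (l * (-(√(‖x‖ ^ 2 + z ^ 2) : ℝ) : ℂ)) / (√(‖x‖ ^ 2 + z ^ 2) : ℝ) with hg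
  have hgi : Integrable g := integrable_cexp_neg_div_sqrt hl hz
  have h := VectorFourier.integral_fourierIntegral_smul_eq_flip
    (L := innerₗ (EuclideanSpace ℝ (Fin 2))) (μ := volume) (ν := volume) (e := Real.fourierChar)
    (f := χ) (g := g ∘ fun v => v + -b)
    Real.continuous_fourierChar continuous_inner χ.integrable (hgi.comp_add_right (-b))
  rw [flip_innerₗ, VectorFourier.fourierIntegral_comp_add_right] at h
  refine (Eq.trans ?_ h).trans ?_
  · refine integral_congr_ae (Eventually.of_forall fun x => ?_)
    simp only [hg, Function.comp_apply, smul_eq_mul, ← sub_eq_add_neg]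
    rfl
  · refine integral_congr_ae (Eventually.of_forall fun ξ => ?_)
    have h1 : VectorFourier.fourierIntegral Real.fourierChar volume
        (innerₗ (EuclideanSpace ℝ (Fin 2))) g ξ = _ := fourier_cexp_neg_div_sqrt hl hz ξ
    simp only [h1, smul_eq_mul, Circle.smul_def, Real.fourierChar_apply, innerₗ_apply_apply,
      inner_neg_left]
    congr 4
    push_cast
    ring

/-- The limiting form of the Weyl formula at a real wave number, tested against a function with
band limit below the wave number. -/
theorem integral_fourier_mul_cexp_div_sqrt {k z : ℝ} (hk : 0 < k) (hz : 0 < z)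
    (b : EuclideanSpace ℝ (Fin 2)) (χ : SchwartzMap (EuclideanSpace ℝ (Fin 2)) ℂ)
    (hχ : tsupport χ ⊆ Metric.ball 0 (k / (2 * Real.pi))) :
    ∫ x, 𝓕 (χ : EuclideanSpace ℝ (Fin 2) → ℂ) x *
      (Complex.exp (Complex.I * k * (√(‖x - b‖ ^ 2 + z ^ 2) : ℝ)) /
        (√(‖x - b‖ ^ 2 + z ^ 2) : ℝ)) =
    ∫ ξ, χ ξ * (Complex.exp (((-2 * Real.pi * inner ℝ b ξ : ℝ) : ℂ) * Complex.I) *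
      (2 * Real.pi * Complex.exp (√(k ^ 2 - 4 * Real.pi ^ 2 * ‖ξ‖ ^ 2) * Complex.I * z) /
        (-(√(k ^ 2 - 4 * Real.pi ^ 2 * ‖ξ‖ ^ 2) * Complex.I)))) := by
  have hpi := Real.pi_pos
  obtain ⟨ρ, hρ, hρχ⟩ := exists_lt_subset_ball (isClosed_tsupport χ) hχ
  have hρ2 : ∀ ξ ∈ tsupport χ, 4 * Real.pi ^ 2 * ‖ξ‖ ^ 2 ≤ 4 * Real.pi ^ 2 * ρ ^ 2 := by
    intro ξ hξ
    have := mem_ball_zero_iff.1 (hρχ hξ)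
    gcongr
  have hδ : ∀ ξ ∈ tsupport χ, 4 * Real.pi ^ 2 * ρ ^ 2 < k ^ 2 := by
    intro ξ hξ
    have h0 : 0 ≤ ρ := (norm_nonneg ξ).trans (mem_ball_zero_iff.1 (hρχ hξ)).le
    rw [lt_div_iff₀ (by positivity)] at hρ
    calc 4 * Real.pi ^ 2 * ρ ^ 2 = (ρ * (2 * Real.pi)) ^ 2 := by ring
      _ < k ^ 2 := by gcongr
  have hrpos : ∀ x : EuclideanSpace ℝ (Fin 2), 0 < √(‖x - b‖ ^ 2 + z ^ 2) := fun x =>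
    Real.sqrt_pos.2 (by positivity)
  have h𝓕 : Integrable (𝓕 (χ : EuclideanSpace ℝ (Fin 2) → ℂ)) := by
    rw [← SchwartzMap.fourier_coe]
    exact SchwartzMap.integrable _
  set δ : ℝ := (k ^ 2 - 4 * Real.pi ^ 2 * ρ ^ 2) / 2 with hδdef
  have hleft : Tendsto (fun ε : ℝ => ∫ x, 𝓕 (χ : EuclideanSpace ℝ (Fin 2) → ℂ) x *
      (Complex.exp (((ε : ℂ) - k * Complex.I) * (-(√(‖x - b‖ ^ 2 + z ^ 2) : ℝ) : ℂ)) /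
        (√(‖x - b‖ ^ 2 + z ^ 2) : ℝ))) (𝓝[>] 0)
      (𝓝 (∫ x, 𝓕 (χ : EuclideanSpace ℝ (Fin 2) → ℂ) x *
      (Complex.exp (Complex.I * k * (√(‖x - b‖ ^ 2 + z ^ 2) : ℝ)) /
        (√(‖x - b‖ ^ 2 + z ^ 2) : ℝ)))) := by
    refine tendsto_integral_filter_of_dominated_convergence
      (fun x => ‖𝓕 (χ : EuclideanSpace ℝ (Fin 2) → ℂ) x‖ * (1 / z)) ?_ ?_
      (h𝓕.norm.mul_const _) ?_
    · exact Eventually.of_forall fun ε => h𝓕.1.mul (Measurable.aestronglyMeasurable (by fun_prop))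
    · filter_upwards [self_mem_nhdsWithin] with ε hε
      have hε : 0 < ε := hε
      refine Eventually.of_forall fun x => ?_
      have h2 := le_sqrt_sq_add_sq_right ‖x - b‖ z
      rw [norm_mul, norm_div, Complex.norm_real, Real.norm_of_nonneg (Real.sqrt_nonneg _),
        Complex.norm_exp]
      gcongr
      rw [Real.exp_le_one_iff, ← Complex.ofReal_neg, Complex.re_mul_ofReal]
      simp only [Complex.sub_re, Complex.ofReal_re, Complex.mul_re, Complex.I_re, Complex.ofReal_im,
        Complex.I_im]
      nlinarith [mul_pos hε (hrpos x)]
    · refine Eventually.of_forall fun x => ?_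
      refine Tendsto.const_mul _ (Tendsto.div_const ?_ _)
      refine (Continuous.tendsto' (by fun_prop) 0 _ ?_).mono_left nhdsWithin_le_nhds
      congr 1
      push_cast
      ring
  have hright : Tendsto (fun ε : ℝ => ∫ ξ, χ ξ *
      (Complex.exp (((-2 * Real.pi * inner ℝ b ξ : ℝ) : ℂ) * Complex.I) *
      (2 * Real.pi * Complex.exp (-((((ε : ℂ) - k * Complex.I) ^ 2 +
        (4 * Real.pi ^ 2 * ‖ξ‖ ^ 2 : ℝ)) ^ (2⁻¹ : ℂ) * z)) /
      (((ε : ℂ) - k * Complex.I) ^ 2 + (4 * Real.pi ^ 2 * ‖ξ‖ ^ 2 : ℝ)) ^ (2⁻¹ : ℂ)))) (𝓝[>] 0)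
      (𝓝 (∫ ξ, χ ξ * (Complex.exp (((-2 * Real.pi * inner ℝ b ξ : ℝ) : ℂ) * Complex.I) *
      (2 * Real.pi * Complex.exp (√(k ^ 2 - 4 * Real.pi ^ 2 * ‖ξ‖ ^ 2) * Complex.I * z) /
        (-(√(k ^ 2 - 4 * Real.pi ^ 2 * ‖ξ‖ ^ 2) * Complex.I)))))) := by
    refine tendsto_integral_filter_of_dominated_convergence
      (fun ξ => ‖χ ξ‖ * (2 * Real.pi / √δ)) ?_ ?_ (χ.integrable.norm.mul_const _) ?_
    · exact Eventually.of_forall fun ε => χ.integrable.1.mul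
        (Measurable.aestronglyMeasurable (by fun_prop))
    · have hev : ∀ᶠ ε : ℝ in 𝓝[>] 0, ε ^ 2 ≤ δ ∨ δ ≤ 0 := by
        rcases le_or_gt δ 0 with h | h
        · exact Eventually.of_forall fun _ => Or.inr h
        · have : Tendsto (fun ε : ℝ => ε ^ 2) (𝓝[>] 0) (𝓝 0) :=
            (Continuous.tendsto' (by fun_prop) 0 _ (by simp)).mono_left nhdsWithin_le_nhds
          filter_upwards [this.eventually_le_const h] with ε hε using Or.inl hε
      filter_upwards [hev] with ε hε
      refine Eventually.of_forall fun ξ => ?_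
      by_cases hξ : ξ ∈ tsupport χ
      · have hδ0 : 0 < δ := by rw [hδdef]; linarith [hδ ξ hξ]
        have hε : ε ^ 2 ≤ δ := hε.resolve_right (not_le.2 hδ0)
        set w : ℂ := ((ε : ℂ) - k * Complex.I) ^ 2 + (4 * Real.pi ^ 2 * ‖ξ‖ ^ 2 : ℝ) with hw
        have hwre : w.re = ε ^ 2 - k ^ 2 + 4 * Real.pi ^ 2 * ‖ξ‖ ^ 2 := by
          rw [hw, Complex.add_re, Complex.ofReal_re]
          simp [sq]
        have hwn : δ ≤ ‖w‖ := by
          have := neg_le_of_abs_le (Complex.abs_re_le_norm w)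
          have := hρ2 ξ hξ
          rw [hwre] at *
          linarith
        have hroot : √δ ≤ ‖w ^ (2⁻¹ : ℂ)‖ := by
          refine Real.sqrt_le_iff.2 ⟨norm_nonneg _, ?_⟩
          rw [← norm_pow]
          have : (w ^ (2⁻¹ : ℂ)) ^ 2 = w := by simp
          rwa [this]
        rw [norm_mul, norm_mul, Complex.norm_exp_ofReal_mul_I, one_mul, norm_div, norm_mul, norm_mul,
          Complex.norm_ofNat, Complex.norm_real, Real.norm_of_nonneg hpi.le]
        have he : ‖Complex.exp (-(w ^ (2⁻¹ : ℂ) * z))‖ ≤ 1 := by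
          rw [Complex.norm_exp, Real.exp_le_one_iff, Complex.neg_re, Complex.re_mul_ofReal,
            Complex.cpow_inv_two_re]
          exact neg_nonpos.2 (by positivity)
        have hsδ : 0 < √δ := Real.sqrt_pos.2 hδ0
        have hnum : 2 * Real.pi * ‖Complex.exp (-(w ^ (2⁻¹ : ℂ) * z))‖ ≤ 2 * Real.pi :=
          mul_le_of_le_one_right (by positivity) he
        exact mul_le_mul_of_nonneg_left (div_le_div₀ (by positivity) hnum hsδ hroot)
          (norm_nonneg _)
      · simp [image_eq_zero_of_notMem_tsupport hξ]
    · refine Eventually.of_forall fun ξ => ?_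
      by_cases hξ : ξ ∈ tsupport χ
      · have hlt : 4 * Real.pi ^ 2 * ‖ξ‖ ^ 2 < k ^ 2 := (hρ2 ξ hξ).trans_lt (hδ ξ hξ)
        have ht := tendsto_cpow_inv_two_of_lt hk hlt
        refine Tendsto.const_mul _ (Tendsto.const_mul _ (Tendsto.div ?_ ht ?_))
        · refine Tendsto.const_mul _ ((Complex.continuous_exp.tendsto _).comp ?_)
          have := (ht.mul_const (z : ℂ)).neg
          rwa [neg_mul, neg_neg] at this
        · have : √(k ^ 2 - 4 * Real.pi ^ 2 * ‖ξ‖ ^ 2) ≠ 0 :=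
            (Real.sqrt_pos.2 (by linarith)).ne'
          simp [this]
      · simp [image_eq_zero_of_notMem_tsupport hξ]
  refine tendsto_nhds_unique hleft (hright.congr' ?_)
  filter_upwards [self_mem_nhdsWithin] with ε hε
  have hε : 0 < ε := hε
  exact (integral_fourier_mul_cexp_neg_div_sqrt (by simpa using hε) hz b χ).symm

theorem integral_mul_cexp_eq_zero_of_integral_mul_cexp_div_sqrt {α : Type*} [MeasurableSpace α]
    {μ : Measure α} [SFinite μ] {g : α → ℂ} (hg : Integrable g μ)
    {b : α → EuclideanSpace ℝ (Fin 2)} (hb : Measurable b) {z : α → ℝ} (hz : Measurable z)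
    {c k : ℝ} (hc : 0 < c) (hk : 0 < k) (hcz : ∀ a, g a ≠ 0 → c ≤ z a)
    (h : ∀ x, ∫ a, g a * (Complex.exp (Complex.I * k * (√(‖x - b a‖ ^ 2 + z a ^ 2) : ℝ)) /
      (√(‖x - b a‖ ^ 2 + z a ^ 2) : ℝ)) ∂μ = 0)
    {ξ : EuclideanSpace ℝ (Fin 2)} (hξ : ‖ξ‖ < k / (2 * Real.pi)) :
    ∫ a, g a * (Complex.exp (((-2 * Real.pi * inner ℝ (b a) ξ : ℝ) : ℂ) * Complex.I) *
      Complex.exp (√(k ^ 2 - 4 * Real.pi ^ 2 * ‖ξ‖ ^ 2) * Complex.I * z a)) ∂μ = 0 := by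
  have hpi := Real.pi_pos
  set κ : EuclideanSpace ℝ (Fin 2) → ℝ := fun ξ => √(k ^ 2 - 4 * Real.pi ^ 2 * ‖ξ‖ ^ 2) with hκ
  set P : EuclideanSpace ℝ (Fin 2) → α → ℂ := fun ξ a =>
    Complex.exp (((-2 * Real.pi * inner ℝ (b a) ξ : ℝ) : ℂ) * Complex.I) *
      Complex.exp (κ ξ * Complex.I * z a) with hP
  set J : EuclideanSpace ℝ (Fin 2) → ℂ := fun ξ => ∫ a, g a * P ξ a ∂μ with hJ
  set W : EuclideanSpace ℝ (Fin 2) → ℂ := fun ξ => 2 * Real.pi / (-(κ ξ * Complex.I)) with hW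
  have hPnorm : ∀ ξ a, ‖P ξ a‖ = 1 := fun ξ a => by
    have : (κ ξ * Complex.I * z a : ℂ) = ((κ ξ * z a : ℝ) : ℂ) * Complex.I := by
      push_cast; ring
    rw [hP]
    simp only
    rw [this, norm_mul, Complex.norm_exp_ofReal_mul_I, Complex.norm_exp_ofReal_mul_I, one_mul]
  have hPmeas : Measurable (Function.uncurry P) := by
    simp only [hP, hκ, Function.uncurry_def]
    fun_prop
  have hJcont : Continuous J := by
    refine continuous_of_dominated (bound := fun a => ‖g a‖)
      (fun ξ => hg.1.mul (hPmeas.of_uncurry_left).aestronglyMeasurable)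
      (fun ξ => Eventually.of_forall fun a => by rw [norm_mul, hPnorm, mul_one]) hg.norm
      (Eventually.of_forall fun a => ?_)
    simp only [hP, hκ]
    fun_prop
  set U : Set (EuclideanSpace ℝ (Fin 2)) := Metric.ball 0 (k / (2 * Real.pi)) with hU
  have hκpos : ∀ ξ ∈ U, 0 < κ ξ := fun ξ hξ => by
    rw [hU, mem_ball_zero_iff, lt_div_iff₀ (by positivity)] at hξ
    refine Real.sqrt_pos.2 ?_
    nlinarith [norm_nonneg ξ, mul_nonneg (norm_nonneg ξ) hpi.le]
  have hWne : ∀ ξ ∈ U, W ξ ≠ 0 := fun ξ hξ => by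
    have := (hκpos ξ hξ).ne'
    simp [hW, this, hpi.ne']
  have hWmeas : Measurable W := by simp only [hW, hκ]; fun_prop
  have hWcont : ContinuousOn W U := by
    refine ContinuousOn.div (by fun_prop) (by simp only [hκ]; fun_prop) fun ξ hξ => ?_
    have := (hκpos ξ hξ).ne'
    simp [this]
  have htest : ∀ χ : SchwartzMap (EuclideanSpace ℝ (Fin 2)) ℂ, HasCompactSupport χ →
      tsupport χ ⊆ U → ∫ ξ, χ ξ * (W ξ * J ξ) = 0 := by
    intro χ hχc hχU
    obtain ⟨C, hC⟩ := hχc.isCompact.exists_bound_of_continuousOn (hWcont.mono hχU)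
    have hint₁ : Integrable (Function.uncurry fun ξ a => χ ξ * (W ξ * (g a * P ξ a)))
        ((volume : Measure (EuclideanSpace ℝ (Fin 2))).prod μ) := by
      refine ((χ.integrable.mul_prod hg).const_mul (C : ℂ)).mono ?_ (Eventually.of_forall ?_)
      · exact χ.integrable.1.comp_fst.mul ((hWmeas.comp measurable_fst).aestronglyMeasurable.mul
          (hg.1.comp_snd.mul hPmeas.aestronglyMeasurable))
      · rintro ⟨ξ, a⟩
        by_cases hξ : ξ ∈ tsupport χ
        · have hCξ := hC ξ hξ
          have hC0 : 0 ≤ C := (norm_nonneg _).trans hCξ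
          simp only [Function.uncurry_apply_pair, norm_mul, hPnorm, Complex.norm_real,
            Real.norm_of_nonneg hC0, mul_one]
          calc ‖χ ξ‖ * (‖W ξ‖ * ‖g a‖) = ‖W ξ‖ * (‖χ ξ‖ * ‖g a‖) := by ring
            _ ≤ _ := by gcongr
        · simp [image_eq_zero_of_notMem_tsupport hξ]
    have h𝓕 : Integrable (𝓕 (χ : EuclideanSpace ℝ (Fin 2) → ℂ)) := by
      rw [← SchwartzMap.fourier_coe]
      exact (𝓕 χ).integrable
    have hint₂ : Integrable (Function.uncurry fun x a =>
        𝓕 (χ : EuclideanSpace ℝ (Fin 2) → ℂ) x * (g a *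
        (Complex.exp (Complex.I * k * (√(‖x - b a‖ ^ 2 + z a ^ 2) : ℝ)) /
      (√(‖x - b a‖ ^ 2 + z a ^ 2) : ℝ))))
        ((volume : Measure (EuclideanSpace ℝ (Fin 2))).prod μ) := by
      refine ((h𝓕.mul_prod hg).const_mul ((1 / c : ℝ) : ℂ)).mono ?_ (Eventually.of_forall ?_)
      · refine h𝓕.1.comp_fst.mul (hg.1.comp_snd.mul (Measurable.aestronglyMeasurable ?_))
        fun_prop
      · rintro ⟨x, a⟩
        by_cases ha : g a = 0
        · simp [ha]
        have h1 : c ≤ √(‖x - b a‖ ^ 2 + z a ^ 2) :=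
          (hcz a ha).trans (le_sqrt_sq_add_sq_right _ _)
        have h2 : (Complex.I * k * (√(‖x - b a‖ ^ 2 + z a ^ 2) : ℝ) : ℂ) =
            ((k * √(‖x - b a‖ ^ 2 + z a ^ 2) : ℝ) : ℂ) * Complex.I := by
          push_cast; ring
        simp only [Function.uncurry_apply_pair, h2]
        rw [norm_mul, norm_mul, norm_div, Complex.norm_exp_ofReal_mul_I, Complex.norm_real,
          Real.norm_of_nonneg (Real.sqrt_nonneg _), norm_mul, norm_mul, Complex.norm_real,
          Real.norm_of_nonneg (by positivity : 0 ≤ 1 / c)]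
        calc _ = 1 / √(‖x - b a‖ ^ 2 + z a ^ 2) *
              (‖𝓕 (χ : EuclideanSpace ℝ (Fin 2) → ℂ) x‖ * ‖g a‖) := by ring
          _ ≤ _ := by gcongr
    calc ∫ ξ, χ ξ * (W ξ * J ξ) = ∫ ξ, ∫ a, χ ξ * (W ξ * (g a * P ξ a)) ∂μ := by
          simp only [hJ, integral_const_mul]
      _ = ∫ a, (∫ ξ, χ ξ * (W ξ * (g a * P ξ a))) ∂μ := integral_integral_swap hint₁
      _ = ∫ a, (∫ x, 𝓕 (χ : EuclideanSpace ℝ (Fin 2) → ℂ) x * (g a *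
          (Complex.exp (Complex.I * k * (√(‖x - b a‖ ^ 2 + z a ^ 2) : ℝ)) /
            (√(‖x - b a‖ ^ 2 + z a ^ 2) : ℝ)))) ∂μ := by
          congr 1 with a
          by_cases ha : g a = 0
          · simp [ha]
          have := congrArg (g a * ·) (integral_fourier_mul_cexp_div_sqrt hk
            (hc.trans_le (hcz a ha)) (b a) χ hχU)
          simp only [← integral_const_mul] at this
          refine Eq.trans ?_ (this.symm.trans ?_)
          · congr 1 with ξ
            simp only [hW, hP, hκ]
            ring
          · congr 1 with x
            ring
      _ = ∫ x, ∫ a, 𝓕 (χ : EuclideanSpace ℝ (Fin 2) → ℂ) x * (g a *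
          (Complex.exp (Complex.I * k * (√(‖x - b a‖ ^ 2 + z a ^ 2) : ℝ)) /
            (√(‖x - b a‖ ^ 2 + z a ^ 2) : ℝ))) ∂μ := (integral_integral_swap hint₂).symm
      _ = 0 := by simp only [integral_const_mul, h, mul_zero, integral_zero]
  have hWJ : ContinuousOn (fun ξ => W ξ * J ξ) U := hWcont.mul hJcont.continuousOn
  have hae := Metric.isOpen_ball.ae_eq_zero_of_integral_contDiff_smul_eq_zero
    (hWJ.locallyIntegrableOn (μ := volume) measurableSet_ball) (fun χ hχ hχc hχU => by
      have hc' : HasCompactSupport (fun ξ => (χ ξ : ℂ)) :=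
        hχc.comp_left (g := fun r : ℝ => (r : ℂ)) (by simp)
      have hd' : ContDiff ℝ (↑(⊤ : ℕ∞)) (fun ξ => (χ ξ : ℂ)) :=
        Complex.ofRealCLM.contDiff.comp hχ
      have hs : tsupport (fun ξ => (χ ξ : ℂ)) ⊆ tsupport χ :=
        closure_mono fun ξ hξ => by simpa using hξ
      have := htest (hc'.toSchwartzMap hd') hc' (hs.trans hχU)
      simpa [Complex.real_smul] using this)
  have hzero := Measure.eqOn_open_of_ae_eq (g := fun _ => (0 : ℂ)) (μ := volume)
    ((ae_restrict_iff' measurableSet_ball).2 hae) Metric.isOpen_ball hWJ continuousOn_const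
  have hξU : ξ ∈ U := mem_ball_zero_iff.2 hξ
  exact (mul_eq_zero.1 (hzero hξU)).resolve_left (hWne ξ hξU)

theorem exists_linearIsometryEquiv_eq_mulVec {n : ℕ} {A : Matrix (Fin n) (Fin n) ℝ}
    (hA : A ∈ Matrix.orthogonalGroup (Fin n) ℝ) :
    ∃ U : EuclideanSpace ℝ (Fin n) ≃ₗᵢ[ℝ] EuclideanSpace ℝ (Fin n), ∀ y,
      (WithLp.equiv 2 (Fin n → ℝ)).symm (A.mulVec (WithLp.equiv 2 (Fin n → ℝ) y)) = U y := by
  have hnorm : ∀ y, ‖Matrix.toEuclideanLin A y‖ = ‖y‖ := fun y => by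
    rw [← sq_eq_sq₀ (norm_nonneg _) (norm_nonneg _), ← real_inner_self_eq_norm_sq,
      ← real_inner_self_eq_norm_sq]
    have h1 : Aᵀ * A = 1 := by
      simpa [Matrix.star_eq_conjTranspose] using (Matrix.mem_orthogonalGroup_iff' (Fin n) ℝ).1 hA
    simp only [EuclideanSpace.inner_eq_star_dotProduct, star_trivial, Matrix.toLpLin_apply]
    rw [Matrix.dotProduct_mulVec, Matrix.vecMul_mulVec]
    simp [h1]
  exact ⟨LinearIsometry.toLinearIsometryEquiv ⟨Matrix.toEuclideanLin A, hnorm⟩ rfl, fun y => rfl⟩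

theorem norm_measPoint_sub (rM : ℝ) (x : EuclideanSpace ℝ (Fin 2))
    (y : EuclideanSpace ℝ (Fin 3)) :
    ‖measPoint rM x - y‖ = √(‖x - !₂[y 0, y 1]‖ ^ 2 + (rM - y 2) ^ 2) := by
  rw [EuclideanSpace.norm_eq, EuclideanSpace.norm_sq_eq]
  simp [measPoint, Fin.sum_univ_three, Fin.sum_univ_two]

theorem fourier_eq_zero_of_integral_born_eq_zero {k rM : ℝ} (hk : 0 < k)
    (U : EuclideanSpace ℝ (Fin 3) ≃ₗᵢ[ℝ] EuclideanSpace ℝ (Fin 3))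
    {f : EuclideanSpace ℝ (Fin 3) → ℂ} (hf : Integrable f)
    (hsupp : tsupport f ⊆ Metric.ball 0 rM)
    (h : ∀ x, ∫ y, f (U y) * Complex.exp (Complex.I * (k : ℂ) * ((y 2 : ℝ) : ℂ)) *
      (Complex.exp (Complex.I * (k : ℂ) * ((‖measPoint rM x - y‖ : ℝ) : ℂ)) /
        ((4 * Real.pi * ‖measPoint rM x - y‖ : ℝ) : ℂ)) = 0)
    {η : EuclideanSpace ℝ (Fin 2)} (hη : ‖η‖ < k) :
    𝓕 f ((2 * Real.pi)⁻¹ • U (semiSpherePoint k η)) = 0 := by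
  have hpi := Real.pi_pos
  obtain ⟨ρ, hρ, hfρ⟩ := exists_lt_subset_ball (isClosed_tsupport f) hsupp
  have hfU : Integrable (fun y => f (U y)) :=
    (U.measurePreserving.integrable_comp_emb U.toMeasurableEquiv.measurableEmbedding).2 hf
  have hg : Integrable (fun y => f (U y) * Complex.exp (Complex.I * (k : ℂ) * ((y 2 : ℝ) : ℂ))) := by
    refine hfU.mul_bdd (c := 1) (Continuous.aestronglyMeasurable (by fun_prop))
      (Eventually.of_forall fun y => ?_)
    have : (Complex.I * k * (y 2 : ℝ) : ℂ) = ((k * y 2 : ℝ) : ℂ) * Complex.I := by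
      push_cast; ring
    rw [this, Complex.norm_exp_ofReal_mul_I]
  have key := integral_mul_cexp_eq_zero_of_integral_mul_cexp_div_sqrt hg
    (b := fun y => !₂[y 0, y 1]) (by fun_prop) (z := fun y => rM - y 2) (by fun_prop)
    (sub_pos.2 hρ) hk (fun y hy => ?_) (fun x => ?_) (ξ := (2 * Real.pi)⁻¹ • η) ?_
  · rw [Real.fourier_eq, ← U.measurePreserving.integral_comp
      U.toMeasurableEquiv.measurableEmbedding]
    have hκ : k ^ 2 - 4 * Real.pi ^ 2 * ‖(2 * Real.pi)⁻¹ • η‖ ^ 2 = k ^ 2 - ‖η‖ ^ 2 := by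
      rw [norm_smul, Real.norm_of_nonneg (by positivity)]
      field_simp
      ring
    rw [hκ] at key
    have hne : Complex.exp (√(k ^ 2 - ‖η‖ ^ 2) * Complex.I * rM) ≠ 0 := Complex.exp_ne_zero _
    refine (mul_eq_zero.1 (Eq.trans ?_ key)).resolve_left hne
    rw [← integral_const_mul]
    congr 1 with y
    rw [inner_smul_right, U.inner_map_map, Circle.smul_def, Real.fourierChar_apply, smul_eq_mul,
      ← Complex.exp_add, mul_assoc (f (U y)), ← Complex.exp_add, ← mul_assoc,
      ← Complex.exp_add, mul_comm _ (f (U y))]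
    have h3 : inner ℝ y (semiSpherePoint k η) =
        y 0 * η 0 + y 1 * η 1 + y 2 * (√(k ^ 2 - ‖η‖ ^ 2) - k) := by
      simp [PiLp.inner_apply, semiSpherePoint, Fin.sum_univ_three, mul_comm]
    have h4 : inner ℝ !₂[y 0, y 1] ((2 * Real.pi)⁻¹ • η) =
        (2 * Real.pi)⁻¹ * (y 0 * η 0 + y 1 * η 1) := by
      simp [PiLp.inner_apply, Fin.sum_univ_two]
      ring
    rw [h3, h4]
    congr 2
    have hpi' : (Real.pi : ℂ) ≠ 0 := by exact_mod_cast hpi.ne'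
    push_cast
    field_simp
    ring
  · have hy' : f (U y) ≠ 0 := left_ne_zero_of_mul hy
    have h1 : ‖y‖ < ρ := by
      have := hfρ (subset_tsupport f hy')
      rwa [mem_ball_zero_iff, U.norm_map] at this
    have h2 := (Real.norm_eq_abs _ ▸ PiLp.norm_apply_le y 2 : |y 2| ≤ ‖y‖)
    linarith [le_abs_self (y 2)]
  · have := h x
    simp only [norm_measPoint_sub] at this
    refine (mul_eq_zero.1 (Eq.trans ?_ this)).resolve_left
      (by simp [hpi.ne'] : ((4 * Real.pi : ℝ) : ℂ)⁻¹ ≠ 0)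
    rw [← integral_const_mul]
    congr 1 with y
    push_cast
    ring
  · rw [norm_smul, Real.norm_of_nonneg (by positivity), inv_mul_eq_div]
    gcongr

theorem integrable_born_integrand {k rM : ℝ}
    (U : EuclideanSpace ℝ (Fin 3) ≃ₗᵢ[ℝ] EuclideanSpace ℝ (Fin 3))
    {f : EuclideanSpace ℝ (Fin 3) → ℂ} (hf : Integrable f)
    (hsupp : tsupport f ⊆ Metric.ball 0 rM) (x : EuclideanSpace ℝ (Fin 2)) :
    Integrable fun y => f (U y) * Complex.exp (Complex.I * (k : ℂ) * ((y 2 : ℝ) : ℂ)) *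
      (Complex.exp (Complex.I * (k : ℂ) * ((‖measPoint rM x - y‖ : ℝ) : ℂ)) /
        ((4 * Real.pi * ‖measPoint rM x - y‖ : ℝ) : ℂ)) := by
  have hpi := Real.pi_pos
  obtain ⟨ρ, hρ, hfρ⟩ := exists_lt_subset_ball (isClosed_tsupport f) hsupp
  have hfU : Integrable (fun y => f (U y)) :=
    (U.measurePreserving.integrable_comp_emb U.toMeasurableEquiv.measurableEmbedding).2 hf
  have hphase : ∀ a : ℝ, ‖Complex.exp (Complex.I * k * a)‖ = 1 := fun a => by
    have : (Complex.I * k * a : ℂ) = ((k * a : ℝ) : ℂ) * Complex.I := by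
      push_cast; ring
    rw [this, Complex.norm_exp_ofReal_mul_I]
  refine (hfU.const_mul ((1 / (4 * Real.pi * (rM - ρ)) : ℝ) : ℂ)).mono
    ((hfU.1.mul (Measurable.aestronglyMeasurable (by fun_prop))).mul
      (Measurable.aestronglyMeasurable (by fun_prop))) (Eventually.of_forall fun y => ?_)
  by_cases hy : f (U y) = 0
  · simp [hy]
  have hr : 0 < rM - ρ := sub_pos.2 hρ
  have h1 : rM - ρ ≤ ‖measPoint rM x - y‖ := by
    have h1 : ‖y‖ < ρ := by
      have := hfρ (subset_tsupport f hy)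
      rwa [mem_ball_zero_iff, U.norm_map] at this
    have h2 := (Real.norm_eq_abs _ ▸ PiLp.norm_apply_le y 2 : |y 2| ≤ ‖y‖)
    rw [norm_measPoint_sub]
    refine Real.le_sqrt_of_sq_le ?_
    nlinarith [le_abs_self (y 2), sq_nonneg ‖x - !₂[y 0, y 1]‖]
  rw [norm_mul, norm_mul, norm_div, hphase, hphase, Complex.norm_real,
    Real.norm_of_nonneg (by positivity), norm_mul, Complex.norm_real,
    Real.norm_of_nonneg (by positivity), mul_one, mul_comm]
  gcongr

end

/-- Uniqueness for optical diffraction tomography (Theorem 3.2 of the paper, `d = 3`):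
if the Fourier-space coverage `Y` has positive Lebesgue measure, then a compactly supported
integrable scattering potential supported in the ball of radius `r_M` is uniquely determined
(up to a null set) by the Born forward data along the rotation. -/
theorem odt_uniqueness (k₀ rM T : ℝ) (hk₀ : 0 < k₀) (hrM : 0 < rM) (hT : 0 < T)
    (R : ℝ → Matrix (Fin 3) (Fin 3) ℝ)
    (hRcont : ContinuousOn R (Icc 0 T))
    (hRSO : ∀ t ∈ Icc (0 : ℝ) T, R t ∈ Matrix.specialOrthogonalGroup (Fin 3) ℝ)
    (f₁ f₂ : EuclideanSpace ℝ (Fin 3) → ℂ)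
    (hf₁ : Integrable f₁) (hf₂ : Integrable f₂)
    (hc₁ : HasCompactSupport f₁) (hc₂ : HasCompactSupport f₂)
    (hsupp₁ : tsupport f₁ ⊆ Metric.ball (0 : EuclideanSpace ℝ (Fin 3)) rM)
    (hsupp₂ : tsupport f₂ ⊆ Metric.ball (0 : EuclideanSpace ℝ (Fin 3)) rM)
    (hYpos : 0 < volume {z : EuclideanSpace ℝ (Fin 3) |
      ∃ y' : EuclideanSpace ℝ (Fin 2), ∃ t ∈ Icc (0 : ℝ) T, ‖y'‖ < k₀ ∧
        z = (WithLp.equiv 2 (Fin 3 → ℝ)).symm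
              ((R t).mulVec (WithLp.equiv 2 (Fin 3 → ℝ) (semiSpherePoint k₀ y')))})
    (heq : ∀ (x' : EuclideanSpace ℝ (Fin 2)) (t : ℝ), t ∈ Icc (0 : ℝ) T →
      fwdData k₀ rM R f₁ x' t = fwdData k₀ rM R f₂ x' t) :
    f₁ =ᵐ[volume] f₂ := by
  have hpi := Real.pi_pos
  have hf : Integrable (f₁ - f₂) := hf₁.sub hf₂
  have hsub : tsupport (f₁ - f₂) ⊆ tsupport f₁ ∪ tsupport f₂ := tsupport_sub f₁ f₂
  have hball : tsupport (f₁ - f₂) ⊆ Metric.ball (0 : EuclideanSpace ℝ (Fin 3)) rM :=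
    hsub.trans (union_subset hsupp₁ hsupp₂)
  have hvanish : (fun w : EuclideanSpace ℝ (Fin 3) => (2 * Real.pi) • w) ⁻¹'
      {z : EuclideanSpace ℝ (Fin 3) |
      ∃ y' : EuclideanSpace ℝ (Fin 2), ∃ t ∈ Icc (0 : ℝ) T, ‖y'‖ < k₀ ∧
        z = (WithLp.equiv 2 (Fin 3 → ℝ)).symm
              ((R t).mulVec (WithLp.equiv 2 (Fin 3 → ℝ) (semiSpherePoint k₀ y')))} ⊆
      {w | FourierTransform.fourier (f₁ - f₂) w = (0 : ℂ)} := by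
    rintro w ⟨η, t, ht, hη, hw⟩
    obtain ⟨U, hU⟩ := exists_linearIsometryEquiv_eq_mulVec
      (Matrix.mem_specialOrthogonalGroup_iff.1 (hRSO t ht)).1
    have hw' : w = (2 * Real.pi)⁻¹ • U (semiSpherePoint k₀ η) := by
      rw [← hU, ← hw, inv_smul_smul₀ (by positivity)]
    change FourierTransform.fourier (f₁ - f₂) w = 0
    rw [hw']
    refine fourier_eq_zero_of_integral_born_eq_zero hk₀ U hf hball (fun x => ?_) hη
    have hx := add_right_cancel (heq x t ht)
    simp only [hU] at hx
    rw [← sub_eq_zero, ← integral_sub (integrable_born_integrand U hf₁ hsupp₁ x)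
      (integrable_born_integrand U hf₂ hsupp₂ x)] at hx
    simpa only [Pi.sub_apply, sub_mul] using hx
  have hvol : volume {w | FourierTransform.fourier (f₁ - f₂) w = (0 : ℂ)} ≠ 0 := by
    refine fun h0 => hYpos.ne' ?_
    have := measure_mono_null hvanish h0
    rw [Measure.addHaar_preimage_smul _ (by positivity)] at this
    refine (mul_eq_zero.1 this).resolve_left ?_
    simp [hpi.ne']
  exact (sub_ae_eq_zero f₁ f₂).1 (ae_eq_zero_of_volume_fourier_zero hf (hc₁.sub hc₂) hvol)
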